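/- For every ε > 0 and integer m ≥ 2, there exists a probability distribution μ on ℤ^m such that: (1) μ satisfies the CC property with parameter ε, i.e. for every v ∈ ℤ^m and every e ∈ Cont(m), Pr_{η∼μ}[η = v] ≤ e^ε · Pr_{η∼μ}[e + η = v] and Pr_{η∼μ}[e + η = v] ≤ e^ε · Pr_{η∼μ}[η = v]; and (2) for every β ∈ (0,1), Pr_{η∼μ}[‖η‖_∞ ≥ (6/ε)·log₂(m)·ln(2m/β)] ≤ β. -/

import Mathlib

open scoped ENNReal

/-- `ContVec m` is the set of 0/1-vectors that are 1 exactly on a nonempty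
contiguous block of indices `{s, …, t}`. -/
def ContVec (m : ℕ) (e : Fin m → ℤ) : Prop :=
  ∃ s t : Fin m, s ≤ t ∧ ∀ i, e i = if s ≤ i ∧ i ≤ t then 1 else 0

/-- `f` changes by a factor of at most `K` when its argument is translated by `u`. -/
def ShiftBound {V : Type*} [AddCommGroup V] (f : V → ℝ≥0∞) (K : ℝ≥0∞) (u : V) : Prop :=
  ∀ v, f v ≤ K * f (v - u) ∧ f (v - u) ≤ K * f v

namespace ShiftBound

variable {V : Type*} [AddCommGroup V] {f : V → ℝ≥0∞} {K K' : ℝ≥0∞} {u w : V}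

lemma zero (f : V → ℝ≥0∞) : ShiftBound f 1 0 := fun v => by simp

lemma mono (h : ShiftBound f K u) (hK : K ≤ K') : ShiftBound f K' u := fun v =>
  ⟨(h v).1.trans (mul_le_mul_left hK _), (h v).2.trans (mul_le_mul_left hK _)⟩

lemma add (hu : ShiftBound f K u) (hw : ShiftBound f K' w) :
    ShiftBound f (K * K') (u + w) := by
  intro v
  rw [← sub_sub]
  constructor
  · calc f v ≤ K * f (v - u) := (hu v).1
      _ ≤ K * (K' * f (v - u - w)) := mul_le_mul_right (hw _).1 _
      _ = _ := (mul_assoc _ _ _).symm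
  · calc f (v - u - w) ≤ K' * f (v - u) := (hw _).2
      _ ≤ K' * (K * f v) := mul_le_mul_right (hu v).2 _
      _ = _ := by rw [← mul_assoc, mul_comm K']

end ShiftBound

section Convolution

variable {V : Type*} [AddCommGroup V]

/-- The mass function of `X + Z • u`, for independent `X` and `Z` with mass functions `f` and
`p`. -/
noncomputable def lineConv (p : ℤ → ℝ≥0∞) (u : V) (f : V → ℝ≥0∞) (v : V) : ℝ≥0∞ :=
  ∑' z : ℤ, p z * f (v - z • u)

lemma ShiftBound.lineConv_of_right {f : V → ℝ≥0∞} {K : ℝ≥0∞} {w : V} (h : ShiftBound f K w)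
    (p : ℤ → ℝ≥0∞) (u : V) : ShiftBound (lineConv p u f) K w := by
  intro v
  unfold lineConv
  simp only [← ENNReal.tsum_mul_left]
  constructor <;> refine ENNReal.tsum_le_tsum fun z => ?_ <;> rw [mul_left_comm, sub_right_comm]
  · exact mul_le_mul_right (h _).1 _
  · exact mul_le_mul_right (h _).2 _

lemma ShiftBound.lineConv_of_left {p : ℤ → ℝ≥0∞} {K : ℝ≥0∞} (h : ShiftBound p K 1)
    (u : V) (f : V → ℝ≥0∞) : ShiftBound (lineConv p u f) K u := by
  intro v
  have key : lineConv p u f (v - u) = ∑' z : ℤ, p (z - 1) * f (v - z • u) := by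
    rw [lineConv, ← (Equiv.subRight (1 : ℤ)).tsum_eq]
    refine tsum_congr fun z => ?_
    simp only [Equiv.subRight_apply, sub_smul, one_smul]
    congr 2
    abel
  rw [key]
  unfold lineConv
  simp only [← ENNReal.tsum_mul_left, ← mul_assoc]
  exact ⟨ENNReal.tsum_le_tsum fun z => mul_le_mul_left (h z).1 _,
    ENNReal.tsum_le_tsum fun z => mul_le_mul_left (h z).2 _⟩

lemma tsum_lineConv_mul (p : ℤ → ℝ≥0∞) (u : V) (f g : V → ℝ≥0∞)
    (hg : ∀ x y, g (x + y) = g x * g y) :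
    ∑' v, lineConv p u f v * g v = (∑' z : ℤ, p z * g (z • u)) * ∑' v, f v * g v := by
  unfold lineConv
  simp only [← ENNReal.tsum_mul_right]
  rw [ENNReal.tsum_comm]
  refine tsum_congr fun z => ?_
  rw [← (Equiv.addRight (z • u)).tsum_eq, ← ENNReal.tsum_mul_left]
  refine tsum_congr fun v => ?_
  simp only [Equiv.coe_addRight, add_sub_cancel_right, hg]
  ring

open Classical in
/-- The mass function of `∑ u ∈ l, Z_u • u`, where the `Z_u` are independent with mass
function `p`. -/
noncomputable def listConv (p : ℤ → ℝ≥0∞) (l : List V) : V → ℝ≥0∞ :=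
  l.foldr (lineConv p) (Pi.single 0 1)

lemma tsum_single_mul (g : V → ℝ≥0∞) [DecidableEq V] :
    ∑' v, (Pi.single 0 1 : V → ℝ≥0∞) v * g v = g 0 := by
  rw [tsum_eq_single 0 fun v hv => by simp [hv]]
  simp

lemma shiftBound_listConv {p : ℤ → ℝ≥0∞} {K : ℝ≥0∞} (h : ShiftBound p K 1) {l : List V} {u : V}
    (hu : u ∈ l) : ShiftBound (listConv p l) K u := by
  induction l with
  | nil => simp at hu
  | cons w l ih =>
    rcases List.mem_cons.1 hu with rfl | hu
    · exact h.lineConv_of_left _ _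
    · exact (ih hu).lineConv_of_right _ _

lemma tsum_listConv {p : ℤ → ℝ≥0∞} (hp : ∑' z, p z = 1) (l : List V) :
    ∑' v, listConv p l v = 1 := by
  induction l with
  | nil => simp [listConv]
  | cons w l ih =>
    have := tsum_lineConv_mul p w (listConv p l) (fun _ => 1) (by simp)
    simp only [mul_one, hp, ih] at this
    exact this

lemma tsum_listConv_mul_le {p : ℤ → ℝ≥0∞} (hp : ∑' z, p z = 1) {g : V → ℝ≥0∞} (hg0 : g 0 = 1)
    (hg : ∀ x y, g (x + y) = g x * g y) {C : ℝ≥0∞} (P : V → Bool) {l : List V}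
    (hP : ∀ u ∈ l, P u = true → ∑' z : ℤ, p z * g (z • u) ≤ C)
    (hN : ∀ u ∈ l, P u = false → ∀ z : ℤ, g (z • u) = 1) :
    ∑' v, listConv p l v * g v ≤ C ^ l.countP P := by
  induction l with
  | nil =>
    classical
    refine Eq.trans_le (b := g 0) ?_ (by simp [hg0])
    exact tsum_single_mul g
  | cons w l ih =>
    have ih := ih (fun u hu => hP u (List.mem_cons_of_mem _ hu))
      fun u hu => hN u (List.mem_cons_of_mem _ hu)
    have step := tsum_lineConv_mul p w (listConv p l) g hg
    refine step.trans_le ?_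
    by_cases hw : P w = true
    · rw [List.countP_cons_of_pos hw, pow_succ']
      exact mul_le_mul' (hP w List.mem_cons_self hw) ih
    · rw [List.countP_cons_of_neg hw]
      simpa [hN w List.mem_cons_self (by simpa using hw), hp] using ih

end Convolution

section DiscreteLaplace

/-- The mass function of the two-sided geometric distribution with ratio `a`. -/
noncomputable def discreteLaplace (a : ℝ) (z : ℤ) : ℝ≥0∞ :=
  ENNReal.ofReal ((1 - a) / (1 + a) * a ^ z.natAbs)

lemma discreteLaplace_neg (a : ℝ) (z : ℤ) : discreteLaplace a (-z) = discreteLaplace a z := by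
  simp [discreteLaplace]

lemma hasSum_pow_natAbs_mul_zpow {a r : ℝ} (hr : 0 < r) (ha : 0 ≤ a) (har : a * r < 1)
    (har' : a / r < 1) :
    HasSum (fun z : ℤ => a ^ z.natAbs * r ^ z) ((1 - a * r)⁻¹ + a / r * (1 - a / r)⁻¹) := by
  refine HasSum.of_nat_of_neg_add_one ?_ ?_
  · simpa [mul_pow] using hasSum_geometric_of_lt_one (mul_nonneg ha hr.le) har
  · refine ((hasSum_geometric_of_lt_one (div_nonneg ha hr.le) har').mul_left (a / r)).congr_fun
      fun n => ?_
    rw [show (-((n : ℤ) + 1)).natAbs = n + 1 by omega, zpow_neg, ← pow_succ', div_pow]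
    norm_cast

lemma tsum_discreteLaplace_mul_zpow {a r : ℝ} (hr : 0 < r) (ha : 0 ≤ a) (ha1 : a < 1)
    (har : a * r < 1) (har' : a / r < 1) :
    ∑' z : ℤ, discreteLaplace a z * ENNReal.ofReal (r ^ z) =
      ENNReal.ofReal ((1 - a) / (1 + a) * ((1 - a * r)⁻¹ + a / r * (1 - a / r)⁻¹)) := by
  have h := (hasSum_pow_natAbs_mul_zpow hr ha har har').mul_left ((1 - a) / (1 + a))
  have h0 : 0 ≤ (1 - a) / (1 + a) := div_nonneg (by linarith) (by linarith)
  rw [← h.tsum_eq, ENNReal.ofReal_tsum_of_nonneg (fun z => by positivity) h.summable]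
  refine tsum_congr fun z => ?_
  rw [discreteLaplace, ← ENNReal.ofReal_mul (by positivity), mul_assoc]

lemma tsum_discreteLaplace {a : ℝ} (ha : 0 ≤ a) (ha1 : a < 1) :
    ∑' z : ℤ, discreteLaplace a z = 1 := by
  have h := tsum_discreteLaplace_mul_zpow one_pos ha ha1 (by simpa) (by simpa)
  simp only [one_zpow, ENNReal.ofReal_one, mul_one, div_one] at h
  rw [h, ENNReal.ofReal_eq_one]
  have : 1 - a ≠ 0 := by linarith
  have : 1 + a ≠ 0 := by linarith
  field_simp

lemma tsum_discreteLaplace_sq_mul_zpow_le {x : ℝ} (hx : 0 < x) (hx1 : x < 1) :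
    ∑' z : ℤ, discreteLaplace (x ^ 2) z * ENNReal.ofReal (x ^ z) ≤ ENNReal.ofReal (4 / 3) := by
  have h3 : x ^ 2 * x < 1 := by
    rw [← pow_succ]; exact pow_lt_one₀ hx.le hx1 (by norm_num)
  have hd : x ^ 2 / x = x := by field_simp
  rw [tsum_discreteLaplace_mul_zpow hx (by positivity)
    (pow_lt_one₀ hx.le hx1 (by norm_num)) h3 (by rwa [hd])]
  refine ENNReal.ofReal_le_ofReal ?_
  have h1 : 1 - x ≠ 0 := by linarith
  have h4 : 1 + x + x ^ 2 ≠ 0 := by positivity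
  have h5 : 1 + x ^ 2 ≠ 0 := by positivity
  have : (1 - x ^ 2) / (1 + x ^ 2) * ((1 - x ^ 2 * x)⁻¹ + x ^ 2 / x * (1 - x ^ 2 / x)⁻¹) =
      (1 + x) ^ 2 / (1 + x + x ^ 2) := by
    rw [hd, show 1 - x ^ 2 * x = (1 - x) * (1 + x + x ^ 2) by ring]
    field_simp
    ring
  rw [this, div_le_div_iff₀ (by positivity) (by norm_num)]
  nlinarith [sq_nonneg (1 - x)]

lemma tsum_discreteLaplace_sq_mul_zpow_neg_le {x : ℝ} (hx : 0 < x) (hx1 : x < 1) :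
    ∑' z : ℤ, discreteLaplace (x ^ 2) z * ENNReal.ofReal (x ^ (-z)) ≤ ENNReal.ofReal (4 / 3) := by
  rw [← (Equiv.neg ℤ).tsum_eq]
  simpa [discreteLaplace_neg] using tsum_discreteLaplace_sq_mul_zpow_le hx hx1

lemma shiftBound_discreteLaplace {a : ℝ} (ha : 0 < a) (ha1 : a < 1) :
    ShiftBound (discreteLaplace a) (ENNReal.ofReal a⁻¹) 1 := by
  have h0 : 0 ≤ (1 - a) / (1 + a) := div_nonneg (by linarith) (by linarith)
  have key : ∀ i j : ℕ, j ≤ i + 1 → ENNReal.ofReal ((1 - a) / (1 + a) * a ^ i) ≤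
      ENNReal.ofReal a⁻¹ * ENNReal.ofReal ((1 - a) / (1 + a) * a ^ j) := by
    intro i j hij
    rw [← ENNReal.ofReal_mul (by positivity), mul_left_comm]
    refine ENNReal.ofReal_le_ofReal (mul_le_mul_of_nonneg_left ?_ h0)
    rw [le_inv_mul_iff₀ ha, ← pow_succ']
    exact pow_le_pow_of_le_one ha.le ha1.le hij
  exact fun z => ⟨key _ _ (by omega), key _ _ (by omega)⟩

end DiscreteLaplace

section Dyadic

/-- The indicator vector of the union of the dyadic blocks of length `2 ^ j` with labels
in `[a, b)`. -/
def dyadicVec (m j a b : ℕ) : Fin m → ℤ :=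
  fun i => if a ≤ i / 2 ^ j ∧ i / 2 ^ j < b then 1 else 0

/-- The indicator vectors of the dyadic blocks of the `L` finest levels. -/
def dyadicList (m L : ℕ) : List (Fin m → ℤ) :=
  (List.range L).flatMap fun j => (List.range m).map fun q => dyadicVec m j q (q + 1)

variable {m : ℕ}

lemma dyadicVec_add {j a b c : ℕ} (hab : a ≤ b) (hbc : b ≤ c) :
    dyadicVec m j a b + dyadicVec m j b c = dyadicVec m j a c := by
  ext i
  simp only [dyadicVec, Pi.add_apply]
  split_ifs <;> omega

lemma dyadicVec_eq_zero {j a b : ℕ} (hab : b ≤ a) : dyadicVec m j a b = 0 := by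
  ext i
  simp only [dyadicVec, Pi.zero_apply]
  split_ifs <;> omega

lemma dyadicVec_succ (j a b : ℕ) :
    dyadicVec m (j + 1) a b = dyadicVec m j (2 * a) (2 * b) := by
  ext i
  simp only [dyadicVec, pow_succ, ← Nat.div_div_eq_div_mul]
  split_ifs <;> omega

lemma dyadicVec_eq_zero_or_one {L : ℕ} {u : Fin m → ℤ} (hu : u ∈ dyadicList m L) (i : Fin m) :
    u i = 0 ∨ u i = 1 := by
  simp only [dyadicList, List.mem_flatMap, List.mem_map] at hu
  obtain ⟨j, -, q, -, rfl⟩ := hu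
  simp only [dyadicVec]
  split_ifs <;> simp

lemma countP_dyadicList_le (L : ℕ) (i : Fin m) :
    (dyadicList m L).countP (fun u => u i = 1) ≤ L := by
  rw [dyadicList, List.countP_flatMap]
  refine (List.sum_le_card_nsmul _ 1 fun n hn => ?_).trans (by simp)
  obtain ⟨j, -, rfl⟩ := List.mem_map.1 hn
  simp only [Function.comp_apply, List.countP_map]
  refine le_trans (List.countP_mono_left fun q _ hq => ?_)
    (List.nodup_iff_count_le_one.1 (List.nodup_range (n := m)) (i / 2 ^ j))
  simp only [Function.comp_apply, dyadicVec] at hq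
  split_ifs at hq with h
  · simp only [beq_iff_eq]; omega
  · simp at hq

variable {f : (Fin m → ℤ) → ℝ≥0∞} {K : ℝ≥0∞} {L : ℕ}

lemma shiftBound_dyadicVec_of_le_succ (hK : 1 ≤ K) (hf : ∀ u ∈ dyadicList m L, ShiftBound f K u)
    {j : ℕ} (hj : j < L) {a b : ℕ} (hab : b ≤ a + 1) : ShiftBound f K (dyadicVec m j a b) := by
  by_cases h : b ≤ a
  · rw [dyadicVec_eq_zero h]
    exact (ShiftBound.zero f).mono hK
  obtain rfl : b = a + 1 := by omega
  by_cases ha : a < m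
  · refine hf _ ?_
    simp only [dyadicList, List.mem_flatMap, List.mem_map, List.mem_range]
    exact ⟨j, hj, a, ha, rfl⟩
  · have : dyadicVec m j a (a + 1) = 0 := by
      ext i
      have := Nat.div_le_self i (2 ^ j)
      simp only [dyadicVec, Pi.zero_apply]
      split_ifs <;> omega
    rw [this]
    exact (ShiftBound.zero f).mono hK

lemma shiftBound_dyadicVec_of_le_add_two (hK : 1 ≤ K)
    (hf : ∀ u ∈ dyadicList m L, ShiftBound f K u)
    {j : ℕ} (hj : j < L) {a b : ℕ} (hab : b ≤ a + 2) :
    ShiftBound f (K ^ 2) (dyadicVec m j a b) := by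
  by_cases h : b ≤ a
  · rw [dyadicVec_eq_zero h]
    exact (ShiftBound.zero f).mono (one_le_pow₀ hK)
  rw [← dyadicVec_add (Nat.le_succ a) (by omega : a + 1 ≤ b), sq]
  exact (shiftBound_dyadicVec_of_le_succ hK hf hj le_rfl).add
    (shiftBound_dyadicVec_of_le_succ hK hf hj (by omega))

lemma shiftBound_dyadicVec (hK : 1 ≤ K) (hf : ∀ u ∈ dyadicList m L, ShiftBound f K u)
    (n : ℕ) {j : ℕ} (hj : j + n + 1 < L) {a b : ℕ} (hb : b ≤ 2 ^ (n + 2)) :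
    ShiftBound f (K ^ (2 * (n + 1))) (dyadicVec m j a b) := by
  induction n generalizing j a b with
  | zero =>
    have hb : b ≤ 4 := by simpa using hb
    by_cases h : b ≤ a + 2
    · exact shiftBound_dyadicVec_of_le_add_two hK hf (by omega) h
    rw [zero_add, mul_one, sq]
    rcases Nat.eq_zero_or_pos a with rfl | ha
    · rw [← dyadicVec_add (by omega : 0 ≤ 2 * 1) (by omega : 2 * 1 ≤ b)]
      refine .add ?_ ?_
      · have := dyadicVec_succ (m := m) j 0 1
        rw [mul_zero] at this
        rw [← this]
        exact shiftBound_dyadicVec_of_le_succ hK hf (by omega) (by omega)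
      · by_cases hb3 : b = 3
        · exact shiftBound_dyadicVec_of_le_succ hK hf (by omega) (by omega)
        · rw [show b = 2 * 2 by omega, ← dyadicVec_succ]
          exact shiftBound_dyadicVec_of_le_succ hK hf (by omega) (by omega)
    · obtain ⟨rfl, rfl⟩ : a = 1 ∧ b = 2 * 2 := by omega
      rw [← dyadicVec_add (by omega : 1 ≤ 2 * 1) (by omega : 2 * 1 ≤ 2 * 2)]
      refine .add (shiftBound_dyadicVec_of_le_succ hK hf (by omega) (by omega)) ?_
      rw [← dyadicVec_succ]
      exact shiftBound_dyadicVec_of_le_succ hK hf (by omega) (by omega)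
  | succ n ih =>
    by_cases h : b ≤ a
    · rw [dyadicVec_eq_zero h]
      exact (ShiftBound.zero f).mono (one_le_pow₀ hK)
    rw [← dyadicVec_add (by omega : a ≤ 2 * ((a + 1) / 2)) (by omega : _ ≤ b),
      ← dyadicVec_add (by omega : 2 * ((a + 1) / 2) ≤ 2 * (b / 2)) (by omega : _ ≤ b),
      ← dyadicVec_succ, show K ^ (2 * (n + 1 + 1)) = K * (K ^ (2 * (n + 1)) * K) by ring]
    refine .add (shiftBound_dyadicVec_of_le_succ hK hf (by omega) (by omega))
      (.add (ih (by omega) ?_) (shiftBound_dyadicVec_of_le_succ hK hf (by omega) (by omega)))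
    rw [show n + 1 + 2 = (n + 2) + 1 by ring, pow_succ] at hb
    omega

lemma ContVec.exists_eq_dyadicVec {e : Fin m → ℤ} (he : ContVec m e) :
    ∃ a b, b ≤ m ∧ e = dyadicVec m 0 a b := by
  obtain ⟨s, t, -, h⟩ := he
  refine ⟨s, t + 1, t.2, ?_⟩
  ext i
  simp only [h, dyadicVec, pow_zero, Nat.div_one, Fin.le_def, Nat.lt_succ_iff]

lemma ContVec.shiftBound (hK : 1 ≤ K) (hf : ∀ u ∈ dyadicList m (L + 1), ShiftBound f K u)
    (hm : m ≤ 2 ^ (L + 1)) {e : Fin m → ℤ} (he : ContVec m e) :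
    ShiftBound f (K ^ (2 * max L 1)) e := by
  obtain ⟨a, b, hb, rfl⟩ := he.exists_eq_dyadicVec
  obtain _ | n := L
  · exact shiftBound_dyadicVec_of_le_add_two hK hf (by omega) (by simp at hm; omega)
  · rw [max_eq_left (by omega)]
    exact shiftBound_dyadicVec hK hf n (by omega) (hb.trans hm)

end Dyadic

section Noise

/-- The mass function of the sum of the dyadic blocks of the `L` finest levels with independent
two-sided geometric coefficients of ratio `x ^ 2`. -/
noncomputable def dyadicNoise (x : ℝ) (m L : ℕ) : (Fin m → ℤ) → ℝ≥0∞ :=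
  listConv (discreteLaplace (x ^ 2)) (dyadicList m L)

variable {x : ℝ} {m L : ℕ}

lemma tsum_dyadicNoise (hx : 0 < x) (hx1 : x < 1) : ∑' v, dyadicNoise x m L v = 1 :=
  tsum_listConv (tsum_discreteLaplace (by positivity) (pow_lt_one₀ hx.le hx1 two_ne_zero)) _

lemma tsum_dyadicNoise_mul_zpow_le (hx : 0 < x) (hx1 : x < 1) (i : Fin m) (σ : ℤ)
    (hσ : σ = 1 ∨ σ = -1) :
    ∑' v, dyadicNoise x m L v * ENNReal.ofReal (x ^ (σ * v i)) ≤ ENNReal.ofReal (4 / 3) ^ L := by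
  refine (tsum_listConv_mul_le (C := ENNReal.ofReal (4 / 3))
    (tsum_discreteLaplace (by positivity) (pow_lt_one₀ hx.le hx1 two_ne_zero))
    (g := fun v : Fin m → ℤ => ENNReal.ofReal (x ^ (σ * v i))) (by simp) (fun v w => ?_)
    (fun u : Fin m → ℤ => u i = 1) (fun u _ hu => ?_) fun u hu h z => ?_).trans
    (pow_le_pow_right₀ (by norm_num) (countP_dyadicList_le L i))
  · rw [← ENNReal.ofReal_mul (by positivity), Pi.add_apply, mul_add, zpow_add₀ hx.ne']
  · have hu : u i = 1 := by simpa using hu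
    simp only [Pi.smul_apply, hu, smul_eq_mul, mul_one]
    rcases hσ with rfl | rfl
    · simpa using tsum_discreteLaplace_sq_mul_zpow_le hx hx1
    · simpa using tsum_discreteLaplace_sq_mul_zpow_neg_le hx hx1
  · have hu : u i = 0 := (dyadicVec_eq_zero_or_one hu i).resolve_right (by simpa using h)
    simp [hu]

/-- Chernoff bound for the largest coordinate of the dyadic noise. -/
lemma tsum_indicator_dyadicNoise_le (hx : 0 < x) (hx1 : x < 1) (T : ℝ) :
    ∑' v, {η : Fin m → ℤ | ∃ i, T ≤ |(η i : ℝ)|}.indicator (dyadicNoise x m L) v ≤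
      ENNReal.ofReal (2 * m * (4 / 3) ^ L * x ^ T) := by
  have hpt : ∀ v, {η : Fin m → ℤ | ∃ i, T ≤ |(η i : ℝ)|}.indicator (dyadicNoise x m L) v ≤
      ∑ i : Fin m, (dyadicNoise x m L v * ENNReal.ofReal (x ^ (1 * v i)) +
        dyadicNoise x m L v * ENNReal.ofReal (x ^ (-1 * v i))) * ENNReal.ofReal (x ^ T) := by
    intro v
    refine Set.indicator_apply_le' ?_ fun _ => zero_le
    rintro ⟨i, hi⟩
    refine le_trans ?_ (Finset.single_le_sum (fun _ _ => zero_le) (Finset.mem_univ i))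
    rw [← mul_add, mul_assoc]
    refine le_mul_of_one_le_right' ?_
    rw [← ENNReal.ofReal_add (by positivity) (by positivity), ← ENNReal.ofReal_mul (by positivity),
      ENNReal.one_le_ofReal, ← Real.rpow_intCast, ← Real.rpow_intCast, add_mul,
      ← Real.rpow_add hx, ← Real.rpow_add hx]
    push_cast
    have p1 : 0 < x ^ (1 * (v i : ℝ) + T) := by positivity
    have p2 : 0 < x ^ (-1 * (v i : ℝ) + T) := by positivity
    rcases le_abs.1 hi with h | h
    · have := Real.one_le_rpow_of_pos_of_le_one_of_nonpos hx hx1.le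
        (by linarith : -1 * (v i : ℝ) + T ≤ 0)
      linarith
    · have := Real.one_le_rpow_of_pos_of_le_one_of_nonpos hx hx1.le
        (by linarith : 1 * (v i : ℝ) + T ≤ 0)
      linarith
  refine (ENNReal.tsum_le_tsum hpt).trans ?_
  rw [Summable.tsum_finsetSum fun _ _ => ENNReal.summable]
  have hi : ∀ i ∈ (Finset.univ : Finset (Fin m)),
      ∑' v, (dyadicNoise x m L v * ENNReal.ofReal (x ^ (1 * v i)) +
        dyadicNoise x m L v * ENNReal.ofReal (x ^ (-1 * v i))) * ENNReal.ofReal (x ^ T) ≤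
      ENNReal.ofReal (2 * (4 / 3) ^ L * x ^ T) := by
    intro i _
    rw [ENNReal.tsum_mul_right, ENNReal.tsum_add, ENNReal.ofReal_mul (by positivity), two_mul,
      ENNReal.ofReal_add (by positivity) (by positivity), ENNReal.ofReal_pow (by norm_num)]
    gcongr
    · exact tsum_dyadicNoise_mul_zpow_le hx hx1 i 1 (.inl rfl)
    · exact tsum_dyadicNoise_mul_zpow_le hx hx1 i (-1) (.inr rfl)
  refine (Finset.sum_le_card_nsmul _ _ _ hi).trans_eq ?_
  rw [Finset.card_univ, Fintype.card_fin, ← ENNReal.ofReal_nsmul, nsmul_eq_mul]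
  congr 1
  ring

lemma ContVec.shiftBound_dyadicNoise (hx : 0 < x) (hx1 : x < 1) (hm : m ≤ 2 ^ (L + 1))
    {e : Fin m → ℤ} (he : ContVec m e) :
    ShiftBound (dyadicNoise x m (L + 1)) (ENNReal.ofReal (x ^ 2)⁻¹ ^ (2 * max L 1)) e := by
  have hx2 : x ^ 2 < 1 := pow_lt_one₀ hx.le hx1 two_ne_zero
  have hx0 : 0 < x ^ 2 := by positivity
  refine he.shiftBound ?_ (fun u hu => shiftBound_listConv
    (shiftBound_discreteLaplace hx0 hx2) hu) hm
  rw [ENNReal.one_le_ofReal]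
  exact (one_le_inv₀ hx0).2 hx2.le

end Noise

lemma four_thirds_pow_le_sqrt {m L : ℕ} (hL : 2 ^ L ≤ m) :
    (4 / 3 : ℝ) ^ (L + 1) ≤ √(2 * m) := by
  refine Real.le_sqrt_of_sq_le ?_
  have h : (2 : ℝ) ^ L ≤ m := by exact_mod_cast hL
  calc ((4 / 3 : ℝ) ^ (L + 1)) ^ 2 = (16 / 9 : ℝ) ^ (L + 1) := by
        rw [← pow_mul, mul_comm, pow_mul]; norm_num
    _ ≤ 2 ^ (L + 1) := by gcongr; norm_num
    _ ≤ 2 * m := by rw [pow_succ']; linarith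

/-- For every `ε > 0` and `m ≥ 2` there is a distribution `μ` on `ℤ^m` satisfying the
CC property with parameter `ε` (for every `v` and `e ∈ Cont(m)`,
`Pr[η = v] ≤ e^ε·Pr[e + η = v]` and `Pr[e + η = v] ≤ e^ε·Pr[η = v]`),
and for every `β ∈ (0,1)`, `Pr[‖η‖_∞ ≥ (6/ε)·log₂(m)·ln(2m/β)] ≤ β`. -/
theorem cc_distribution_exists (ε : ℝ) (hε : 0 < ε) (m : ℕ) (hm : 2 ≤ m) :
    ∃ μ : PMF (Fin m → ℤ),
      (∀ v e : Fin m → ℤ, ContVec m e →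
        μ v ≤ ENNReal.ofReal (Real.exp ε) * μ (fun i => v i - e i) ∧
        μ (fun i => v i - e i) ≤ ENNReal.ofReal (Real.exp ε) * μ v) ∧
      (∀ β : ℝ, 0 < β → β < 1 →
        μ.toOuterMeasure
            {η | ∃ i, (6 / ε) * Real.logb 2 m * Real.log (2 * m / β) ≤ |(η i : ℝ)|}
          ≤ ENNReal.ofReal β) := by
  obtain ⟨L, hLm, hmL⟩ : ∃ L, 2 ^ L ≤ m ∧ m ≤ 2 ^ (L + 1) :=
    ⟨Nat.log 2 m, Nat.pow_log_le_self 2 (by omega), (Nat.lt_pow_succ_log_self one_lt_two m).le⟩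
  have hm0 : (0 : ℝ) < m := by positivity
  have hlog1 : 1 ≤ Real.logb 2 m := by
    rw [Real.le_logb_iff_rpow_le one_lt_two hm0]
    simpa using (by exact_mod_cast hm : (2 : ℝ) ≤ m)
  have hlogL : (L : ℝ) ≤ Real.logb 2 m := by
    rw [Real.le_logb_iff_rpow_le one_lt_two hm0, Real.rpow_natCast]
    exact_mod_cast hLm
  set ℓ := Real.logb 2 m
  have hℓ : 0 < ℓ := by linarith
  set x := Real.exp (-(ε / (4 * ℓ))) with hxdef
  have hx : 0 < x := Real.exp_pos _
  have hx1 : x < 1 := Real.exp_lt_one_iff.2 (neg_neg_of_pos (by positivity))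
  obtain ⟨μ, hμ⟩ : ∃ μ : PMF (Fin m → ℤ), ⇑μ = dyadicNoise x m (L + 1) :=
    ⟨⟨_, ENNReal.summable.hasSum_iff.2 (tsum_dyadicNoise hx hx1)⟩, rfl⟩
  refine ⟨μ, fun v e he => ?_, fun β hβ hβ1 => ?_⟩
  · rw [hμ]
    refine (he.shiftBound_dyadicNoise hx hx1 hmL).mono ?_ v
    rw [← ENNReal.ofReal_pow (by positivity)]
    refine ENNReal.ofReal_le_ofReal ?_
    rw [hxdef, ← Real.exp_nat_mul, ← Real.exp_neg, ← Real.exp_nat_mul, Real.exp_le_exp]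
    have h : ((max L 1 : ℕ) : ℝ) ≤ ℓ := by
      rw [Nat.cast_max]; exact max_le hlogL (by simpa using hlog1)
    push_cast at h ⊢
    calc _ = max (L : ℝ) 1 * (ε / ℓ) := by field_simp; ring
      _ ≤ ℓ * (ε / ℓ) := by gcongr
      _ = ε := by field_simp
  · rw [PMF.toOuterMeasure_apply, hμ]
    refine (tsum_indicator_dyadicNoise_le hx hx1 _).trans (ENNReal.ofReal_le_ofReal ?_)
    have hy : 0 < 2 * m / β := by positivity
    have hxT : x ^ (6 / ε * ℓ * Real.log (2 * m / β)) = (β / (2 * m)) * √(β / (2 * m)) := by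
      have hz : 0 < β / (2 * m) := by positivity
      rw [hxdef, ← Real.exp_mul, Real.sqrt_eq_rpow, ← Real.rpow_one_add' hz.le (by norm_num),
        Real.rpow_def_of_pos hz, ← inv_div β, Real.log_inv]
      congr 1
      field_simp
      ring
    rw [hxT, Real.sqrt_div hβ.le]
    have hs : 0 < √(2 * m : ℝ) := Real.sqrt_pos.2 (by positivity)
    calc _ ≤ 2 * m * √(2 * m) * (β / (2 * m) * (√β / √(2 * m))) := by
          gcongr; exact four_thirds_pow_le_sqrt hLm
      _ = β * √β := by field_simp
      _ ≤ β := mul_le_of_le_one_right hβ.le (Real.sqrt_le_one.2 hβ1.le)
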